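/- (Combined estimate in the proof of Lemma 3) Let A be a finite family of n rectangles with widths wᵢ and heights lᵢ, and let ΔA = (Δw₁, Δl₁, …, Δwₙ, Δlₙ) be such that A′ = A + ΔA has all sides positive. Then |T₀(A′) − T₀(A)| ≤ (Σₖ lₖ + Σₖ|Δlₖ|)·(Σₖ|Δwₖ|) + (Σₖ wₖ + Σₖ|Δwₖ|)·(Σₖ|Δlₖ|) + (Σₖ|Δwₖ|)·(Σₖ|Δlₖ|). -/

import Mathlib

open Set Finset Function

/-- A positioning of a family of rectangles (widths `w`, heights `l`) assigns
lower-left corners `(a i, b i)` so that the open interiors are pairwise disjoint. -/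
def IsPositioning {ι : Type*} (w l a b : ι → ℝ) : Prop :=
  ∀ i j, i ≠ j →
    Disjoint (Set.Ioo (a i) (a i + w i) ×ˢ Set.Ioo (b i) (b i + l i))
             (Set.Ioo (a j) (a j + w j) ×ˢ Set.Ioo (b j) (b j + l j))

/-- Horizontal extent `p(M) = max_{i,j} ((a i + w i) - a j)`. -/
noncomputable def pval {n : ℕ} (w a : Fin n → ℝ) : ℝ :=
  ⨆ i, ⨆ j, (a i + w i - a j)

/-- Vertical extent `q(M) = max_{i,j} ((b i + l i) - b j)`. -/
noncomputable def qval {n : ℕ} (l b : Fin n → ℝ) : ℝ :=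
  ⨆ i, ⨆ j, (b i + l i - b j)

/-- Bounding area `T(M) = p(M) * q(M)`. -/
noncomputable def Tval {n : ℕ} (w l a b : Fin n → ℝ) : ℝ :=
  pval w a * qval l b

/-- Total area `S(A) = ∑ i, w i * l i`. -/
noncomputable def Sval {n : ℕ} (w l : Fin n → ℝ) : ℝ :=
  ∑ i, w i * l i

/-- Packing efficiency `η(M) = S(A) / T(M)`. -/
noncomputable def eta {n : ℕ} (w l a b : Fin n → ℝ) : ℝ :=
  Sval w l / Tval w l a b

/-- Best packing efficiency `η₀(A) = sup over positionings M of η(M)`. -/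
noncomputable def eta0 {n : ℕ} (w l : Fin n → ℝ) : ℝ :=
  sSup {e | ∃ a b : Fin n → ℝ, IsPositioning w l a b ∧ e = eta w l a b}

/-- Minimal bounding area `T₀(A) = inf over positionings M of T(M)`. -/
noncomputable def T0 {n : ℕ} (w l : Fin n → ℝ) : ℝ :=
  sInf {t | ∃ a b : Fin n → ℝ, IsPositioning w l a b ∧ t = Tval w l a b}

theorem isPositioning_iff {ι : Type*} {w l a b : ι → ℝ} (hw : ∀ i, 0 < w i) (hl : ∀ i, 0 < l i) :
    IsPositioning w l a b ↔ ∀ i j, i ≠ j →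
      (a i + w i ≤ a j ∨ a j + w j ≤ a i) ∨ (b i + l i ≤ b j ∨ b j + l j ≤ b i) := by
  refine forall₃_congr fun i j _ => ?_
  have := hw i
  have := hw j
  have := hl i
  have := hl j
  rw [Set.disjoint_prod, Set.Ioo_disjoint_Ioo, Set.Ioo_disjoint_Ioo]
  simp only [min_le_iff, le_max_iff]
  grind

theorem le_pval {n : ℕ} (w a : Fin n → ℝ) (i j : Fin n) : a i + w i - a j ≤ pval w a :=
  (le_ciSup (f := fun j => a i + w i - a j) (Set.finite_range _).bddAbove j).trans
    (le_ciSup (f := fun i => ⨆ j, (a i + w i - a j)) (Set.finite_range _).bddAbove i)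

theorem pval_le {n : ℕ} {w a : Fin (n + 1) → ℝ} {c : ℝ} (h : ∀ i j, a i + w i - a j ≤ c) :
    pval w a ≤ c :=
  ciSup_le fun i => ciSup_le fun j => h i j

theorem pval_nonneg {n : ℕ} {w : Fin (n + 1) → ℝ} (hw : ∀ i, 0 < w i) (a : Fin (n + 1) → ℝ) :
    0 ≤ pval w a := by
  linarith [le_pval w a 0 0, hw 0]

theorem qval_eq_pval {n : ℕ} (l b : Fin n → ℝ) : qval l b = pval l b := rfl

/-- Shift each interval by the total perturbation of the intervals starting before it. -/
theorem exists_shift_pval_le_add {n : ℕ} {w w' : Fin (n + 1) → ℝ} (hw : ∀ i, 0 < w i)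
    (a : Fin (n + 1) → ℝ) :
    ∃ a' : Fin (n + 1) → ℝ, (∀ i j, a i + w i ≤ a j → a' i + w' i ≤ a' j) ∧
      pval w' a' ≤ pval w a + ∑ k, |w' k - w k| := by
  have hle (i : Fin (n + 1)) (s t : Finset (Fin (n + 1))) (hi : i ∉ s) (hst : insert i s ⊆ t) :
      ∑ k ∈ s, |w' k - w k| + (w' i - w i) ≤ ∑ k ∈ t, |w' k - w k| := by
    have h := Finset.sum_le_sum_of_subset_of_nonneg (f := fun k => |w' k - w k|) hst
      fun k _ _ => abs_nonneg _
    rw [Finset.sum_insert hi] at h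
    linarith [le_abs_self (w' i - w i)]
  refine ⟨fun j => a j + ∑ k with a k < a j, |w' k - w k|, fun i j hij => ?_,
    pval_le fun i j => ?_⟩
  · have := hle i {k | a k < a i} {k | a k < a j} (by simp) (by
      intro k
      have := hw i
      simp only [Finset.mem_insert, Finset.mem_filter, Finset.mem_univ, true_and]
      rintro (rfl | hk) <;> linarith)
    dsimp only
    linarith
  · have := hle i {k | a k < a i} Finset.univ (by simp) (Finset.subset_univ _)
    have := le_pval w a i j
    have : 0 ≤ ∑ k with a k < a j, |w' k - w k| := Finset.sum_nonneg fun k _ => abs_nonneg _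
    linarith

/-- Place each interval after the total length of the intervals starting before it. -/
theorem exists_shift_pval_le_sum {n : ℕ} {w w' : Fin (n + 1) → ℝ} (hw : ∀ i, 0 < w i)
    (hw' : ∀ i, 0 < w' i) (a : Fin (n + 1) → ℝ) :
    ∃ a' : Fin (n + 1) → ℝ, (∀ i j, a i + w i ≤ a j → a' i + w' i ≤ a' j) ∧
      pval w' a' ≤ ∑ k, w' k := by
  have hle (i : Fin (n + 1)) (s t : Finset (Fin (n + 1))) (hi : i ∉ s) (hst : insert i s ⊆ t) :
      ∑ k ∈ s, w' k + w' i ≤ ∑ k ∈ t, w' k := by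
    have h := Finset.sum_le_sum_of_subset_of_nonneg hst fun k _ _ => (hw' k).le
    rw [Finset.sum_insert hi] at h
    linarith
  refine ⟨fun j => ∑ k with a k < a j, w' k, fun i j hij => ?_, pval_le fun i j => ?_⟩
  · refine hle i {k | a k < a i} {k | a k < a j} (by simp) ?_
    intro k
    have := hw i
    simp only [Finset.mem_insert, Finset.mem_filter, Finset.mem_univ, true_and]
    rintro (rfl | hk) <;> linarith
  · have := hle i {k | a k < a i} Finset.univ (by simp) (Finset.subset_univ _)
    have : 0 ≤ ∑ k with a k < a j, w' k := Finset.sum_nonneg fun k _ => (hw' k).le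
    linarith

theorem exists_shift_pval_le {n : ℕ} {w w' : Fin (n + 1) → ℝ} (hw : ∀ i, 0 < w i)
    (hw' : ∀ i, 0 < w' i) (a : Fin (n + 1) → ℝ) :
    ∃ a' : Fin (n + 1) → ℝ, (∀ i j, a i + w i ≤ a j → a' i + w' i ≤ a' j) ∧
      pval w' a' ≤ min (pval w a) (∑ k, w k) + ∑ k, |w' k - w k| := by
  rcases le_total (pval w a) (∑ k, w k) with h | h
  · rw [min_eq_left h]
    exact exists_shift_pval_le_add hw a
  · rw [min_eq_right h]
    obtain ⟨a', h₁, h₂⟩ := exists_shift_pval_le_sum hw hw' a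
    refine ⟨a', h₁, h₂.trans ?_⟩
    rw [← Finset.sum_add_distrib]
    exact Finset.sum_le_sum fun k _ => by linarith [le_abs_self (w' k - w k)]

theorem exists_isPositioning {n : ℕ} {w l : Fin (n + 1) → ℝ} (hw : ∀ i, 0 < w i)
    (hl : ∀ i, 0 < l i) : ∃ a b, IsPositioning w l a b := by
  obtain ⟨a, ha, -⟩ := exists_shift_pval_le_sum (w := fun _ => 1) (fun _ => one_pos) hw
    fun i => (i : ℝ)
  refine ⟨a, 0, (isPositioning_iff hw hl).2 fun i j hij => Or.inl ?_⟩
  refine hij.lt_or_gt.imp (fun h => ha _ _ ?_) fun h => ha _ _ ?_ <;>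
    exact_mod_cast Nat.succ_le_of_lt h

theorem T0_le_Tval {n : ℕ} {w l a b : Fin (n + 1) → ℝ} (hw : ∀ i, 0 < w i) (hl : ∀ i, 0 < l i)
    (h : IsPositioning w l a b) : T0 w l ≤ Tval w l a b := by
  refine csInf_le ⟨0, ?_⟩ ⟨a, b, h, rfl⟩
  rintro _ ⟨a, b, -, rfl⟩
  exact mul_nonneg (pval_nonneg hw a) (pval_nonneg hl b)

theorem T0_le_T0_add {n : ℕ} {w l w' l' : Fin (n + 1) → ℝ}
    (hw : ∀ i, 0 < w i) (hl : ∀ i, 0 < l i) (hw' : ∀ i, 0 < w' i) (hl' : ∀ i, 0 < l' i) :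
    T0 w' l' ≤ T0 w l + ((∑ k, l k) * (∑ k, |w' k - w k|) + (∑ k, w k) * (∑ k, |l' k - l k|)
      + (∑ k, |w' k - w k|) * (∑ k, |l' k - l k|)) := by
  rw [← sub_le_iff_le_add]
  obtain ⟨a₀, b₀, h₀⟩ := exists_isPositioning hw hl
  refine le_csInf ⟨_, a₀, b₀, h₀, rfl⟩ ?_
  rintro _ ⟨a, b, h, rfl⟩
  rw [isPositioning_iff hw hl] at h
  obtain ⟨a', ha, hp⟩ := exists_shift_pval_le hw hw' a
  obtain ⟨b', hb, hq⟩ := exists_shift_pval_le hl hl' b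
  have h' : IsPositioning w' l' a' b' := (isPositioning_iff hw' hl').2 fun i j hij =>
    (h i j hij).imp (Or.imp (ha i j) (ha j i)) (Or.imp (hb i j) (hb j i))
  have hT := T0_le_Tval hw' hl' h'
  have hdw : 0 ≤ ∑ k, |w' k - w k| := Finset.sum_nonneg fun k _ => abs_nonneg _
  have hdl : 0 ≤ ∑ k, |l' k - l k| := Finset.sum_nonneg fun k _ => abs_nonneg _
  have hP : 0 ≤ min (pval w a) (∑ k, w k) :=
    le_min (pval_nonneg hw a) (Finset.sum_nonneg fun k _ => (hw k).le)
  have hQ : 0 ≤ min (pval l b) (∑ k, l k) :=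
    le_min (pval_nonneg hl b) (Finset.sum_nonneg fun k _ => (hl k).le)
  have hprod := mul_le_mul hp hq (pval_nonneg hl' b') (add_nonneg hP hdw)
  have hPQ := mul_le_mul (min_le_left (pval w a) (∑ k, w k)) (min_le_left (pval l b) (∑ k, l k))
    hQ (pval_nonneg hw a)
  have hPl := mul_le_mul_of_nonneg_right (min_le_right (pval w a) (∑ k, w k)) hdl
  have hQw := mul_le_mul_of_nonneg_right (min_le_right (pval l b) (∑ k, l k)) hdw
  rw [Tval, qval_eq_pval] at hT ⊢
  linarith

/-- Combined estimate in the proof of Lemma 3: an explicit bound on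
`|T₀(A + ΔA) − T₀(A)|` in terms of the side sums and the perturbation sums. -/
theorem T0_perturbation_estimate {n : ℕ} (w l Δw Δl : Fin (n + 1) → ℝ)
    (hw : ∀ i, 0 < w i) (hl : ∀ i, 0 < l i)
    (hw' : ∀ i, 0 < w i + Δw i) (hl' : ∀ i, 0 < l i + Δl i) :
    |T0 (fun i => w i + Δw i) (fun i => l i + Δl i) - T0 w l|
      ≤ ((∑ k, l k) + ∑ k, |Δl k|) * (∑ k, |Δw k|)
        + ((∑ k, w k) + ∑ k, |Δw k|) * (∑ k, |Δl k|)
        + (∑ k, |Δw k|) * (∑ k, |Δl k|) := by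
  have hdw : 0 ≤ ∑ k, |Δw k| := Finset.sum_nonneg fun k _ => abs_nonneg _
  have hdl : 0 ≤ ∑ k, |Δl k| := Finset.sum_nonneg fun k _ => abs_nonneg _
  have h₁ := T0_le_T0_add hw hl hw' hl'
  have h₂ := T0_le_T0_add hw' hl' hw hl
  simp only [add_sub_cancel_left, sub_add_cancel_left, abs_neg, Finset.sum_add_distrib] at h₁ h₂
  have hW : ∑ k, Δw k ≤ ∑ k, |Δw k| := Finset.sum_le_sum fun k _ => le_abs_self _
  have hL : ∑ k, Δl k ≤ ∑ k, |Δl k| := Finset.sum_le_sum fun k _ => le_abs_self _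
  have := mul_le_mul_of_nonneg_right hW hdl
  have := mul_le_mul_of_nonneg_right hL hdw
  have := mul_nonneg hdw hdl
  rw [abs_le]
  constructor <;> linarith
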